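/- Let Γ be a group acting by graph automorphisms on a simple graph T which is a tree (connected and acyclic). Let Ẽ denote the set of oriented edges of T, that is, ordered pairs (u,v) of adjacent vertices, with the induced Γ-action, and let π be the associated permutation representation of Γ on ℓ²(Ẽ). Then at least one of the following holds: (a) some vertex of T is fixed by every element of Γ; (b) some unordered pair {u,v} of adjacent vertices is preserved setwise by every element of Γ; or (c) H¹(Γ, π) ≠ 0, i.e. there exists a map b : Γ → ℓ²(Ẽ) satisfying b(γη) = b(γ) + π(γ)b(η) for all γ, η ∈ Γ which is not of the form b(γ) = π(γ)f − f for any fixed f ∈ ℓ²(Ẽ). -/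

import Mathlib

noncomputable section

/-- The set of oriented edges of a simple graph. -/
abbrev OEdges {V : Type*} (T : SimpleGraph V) : Type _ := {e : V × V // T.Adj e.1 e.2}

section Helpers
variable {V : Type*} {T : SimpleGraph V}

lemma tree_sep (hT : T.IsTree) {u w v : V} (h : T.dist u w + T.dist w v = T.dist u v) (o : V) :
    T.dist u w + T.dist w o = T.dist u o ∨ T.dist v w + T.dist w o = T.dist v o := by
  classical
  obtain ⟨p, hp⟩ := hT.connected.exists_walk_length_eq_dist u w
  obtain ⟨p', hp'⟩ := hT.connected.exists_walk_length_eq_dist w v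
  obtain ⟨q, hq⟩ := hT.connected.exists_walk_length_eq_dist u o
  obtain ⟨q', hq'⟩ := hT.connected.exists_walk_length_eq_dist v o
  have h1 : (p.append p').IsPath := by
    apply SimpleGraph.Walk.isPath_of_length_eq_dist
    rw [SimpleGraph.Walk.length_append]; omega
  have h2 : (q.append q'.reverse).bypass = p.append p' :=
    (hT.existsUnique_path u v).unique (SimpleGraph.Walk.bypass_isPath _) h1
  have h3 : w ∈ (q.append q'.reverse).support := by
    apply SimpleGraph.Walk.support_bypass_subset_support
    rw [h2]; simp
  have key : ∀ {a : V} (r : T.Walk a o), r.length = T.dist a o → w ∈ r.support →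
      T.dist a w + T.dist w o = T.dist a o := by
    intro a r hr hw
    have e := congrArg SimpleGraph.Walk.length (r.take_spec hw)
    rw [SimpleGraph.Walk.length_append] at e
    have e1 := SimpleGraph.dist_le (r.takeUntil w hw)
    have e2 := SimpleGraph.dist_le (r.dropUntil w hw)
    have e3 := hT.connected.dist_triangle (u := a) (v := w) (w := o)
    omega
  rw [SimpleGraph.Walk.mem_support_append_iff] at h3
  rcases h3 with h3 | h3
  · exact Or.inl (key q hq h3)
  · exact Or.inr (key q' hq' (by simpa using h3))

lemma geod (hT : T.IsTree) (x y : V) : ∃ g : ℕ → V,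
    (∀ i, i ≤ T.dist x y → T.dist x (g i) = i ∧ T.dist (g i) y = T.dist x y - i) ∧
    ∀ i, i < T.dist x y → T.Adj (g i) (g (i+1)) := by
  obtain ⟨p, hp⟩ := hT.connected.exists_walk_length_eq_dist x y
  refine ⟨p.getVert, fun i hi => ?_, fun i hi => p.adj_getVert_succ (by omega)⟩
  have e1 := SimpleGraph.dist_le (p.take i)
  have e2 := SimpleGraph.dist_le (p.drop i)
  have e3 := hT.connected.dist_triangle (u := x) (v := p.getVert i) (w := y)
  rw [SimpleGraph.Walk.take_length] at e1
  rw [SimpleGraph.Walk.drop_length] at e2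
  omega

/-- Direction of an oriented edge relative to a base vertex. -/
def hdir (T : SimpleGraph V) (x : V) (e : OEdges T) : ℤ := (T.dist x e.1.2 : ℤ) - T.dist x e.1.1

lemma hdir_adj (hT : T.IsTree) {x x' : V} (hx : T.Adj x x') (e : OEdges T)
    (he : hdir T x e ≠ hdir T x' e) : e.1 = (x, x') ∨ e.1 = (x', x) := by
  have main : ∀ {x x' u v : V}, T.Adj x x' → T.Adj u v → T.dist x v = T.dist x u + 1 →
      T.dist x' u = T.dist x' v + 1 → u = x ∧ v = x' := by
    intro x x' u v hx huv h1 h2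
    have a1 := hT.dist_eq_dist_add_one_of_adj u hx
    have a2 := hT.dist_eq_dist_add_one_of_adj v hx
    have c1 : T.dist x' x = 1 := SimpleGraph.dist_eq_one_iff_adj.2 hx.symm
    have c2 : T.dist u v = 1 := SimpleGraph.dist_eq_one_iff_adj.2 huv
    rw [T.dist_comm (u := u), T.dist_comm (u := u)] at a1
    rw [T.dist_comm (u := v), T.dist_comm (u := v)] at a2
    have := tree_sep hT (u := x') (w := x) (v := u) (by omega) v
    have hxu : T.dist x u = 0 := by
      rw [T.dist_comm (u := u) (v := x)] at this
      omega
    have hxv : T.dist x' v = 0 := by omega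
    exact ⟨(hT.connected.dist_eq_zero_iff.1 hxu).symm, (hT.connected.dist_eq_zero_iff.1 hxv).symm⟩
  obtain ⟨⟨u, v⟩, huv⟩ := e
  simp only [hdir] at he huv
  have b1 := hT.dist_eq_dist_add_one_of_adj x huv
  have b2 := hT.dist_eq_dist_add_one_of_adj x' huv
  rcases b1 with b1 | b1 <;> rcases b2 with b2 | b2
  · omega
  · obtain ⟨h1, h2⟩ := main hx huv.symm b1 b2
    right; simp [h1, h2]
  · obtain ⟨h1, h2⟩ := main hx huv b1 b2
    left; simp [h1, h2]
  · omega

lemma hdir_fin (hT : T.IsTree) (x y : V) : {e : OEdges T | hdir T x e ≠ hdir T y e}.Finite := by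
  obtain ⟨p⟩ := hT.connected x y
  induction p with
  | nil => simp
  | @cons a b d h p ih =>
    have : {e : OEdges T | hdir T a e ≠ hdir T b e}.Finite := by
      refine Set.Finite.subset (Set.Finite.preimage Subtype.val_injective.injOn
        (Set.toFinite {(a, b), (b, a)})) ?_
      intro e he
      simpa using hdir_adj hT h e he
    refine (this.union ih).subset ?_
    intro e he
    by_contra hc
    simp only [Set.mem_union, Set.mem_ofPred_eq, not_or, not_not] at hc
    exact he (hc.1.trans hc.2)

lemma center {Γ : Type*} [Group Γ] (hT : T.IsTree) (c : Γ →* Equiv.Perm V)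
    (hd : ∀ γ u v, T.dist (c γ u) (c γ v) = T.dist u v) (x : V) (N : ℕ)
    (hN : ∀ γ, T.dist x (c γ x) ≤ N) :
    (∃ w : V, ∀ γ : Γ, c γ w = w) ∨
    (∃ u v : V, T.Adj u v ∧
      ∀ γ : Γ, (c γ u = u ∧ c γ v = v) ∨ (c γ u = v ∧ c γ v = u)) := by
  classical
  have hex : ∃ R, ∃ v, ∀ γ, T.dist v (c γ x) ≤ R := ⟨N, x, hN⟩
  obtain ⟨u, hu⟩ := Nat.find_spec hex
  have hmin := fun m => Nat.find_min hex (m := m)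
  generalize Nat.find hex = R at hu hmin
  have hinv : ∀ γ v, (∀ η, T.dist v (c η x) ≤ R) → ∀ η, T.dist (c γ v) (c η x) ≤ R := by
    intro γ v hv η
    have := hd γ v (c (γ⁻¹ * η) x)
    rw [← Equiv.Perm.mul_apply, ← map_mul, mul_inv_cancel_left] at this
    rw [this]; exact hv _
  have hclose : ∀ u v, (∀ η, T.dist u (c η x) ≤ R) → (∀ η, T.dist v (c η x) ≤ R) → u ≠ v →
      T.Adj u v := by
    intro u v hu hv huv
    by_contra hna
    have h0 : T.dist u v ≠ 0 := fun h => huv (hT.connected.dist_eq_zero_iff.1 h)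
    have h1 : T.dist u v ≠ 1 := fun h => hna (SimpleGraph.dist_eq_one_iff_adj.1 h)
    obtain ⟨g, hg, -⟩ := geod hT u v
    obtain ⟨g1, g2⟩ := hg 1 (by omega)
    have hw : ∀ η, T.dist (g 1) (c η x) + 1 ≤ R := by
      intro η
      have k1 := hu η
      have k2 := hv η
      have := tree_sep hT (u := u) (w := g 1) (v := v) (by omega) (c η x)
      rw [T.dist_comm (u := v) (v := g 1)] at this
      omega
    have := hw 1
    exact hmin (R-1) (by omega) ⟨g 1, fun η => by have := hw η; omega⟩
  by_cases hall : ∀ v, (∀ η, T.dist v (c η x) ≤ R) → v = u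
  · left
    exact ⟨u, fun γ => hall _ (hinv γ u hu)⟩
  · right
    push Not at hall
    obtain ⟨v, hv, hvu⟩ := hall
    have huv := hclose u v hu hv hvu.symm
    have htwo : ∀ w, (∀ η, T.dist w (c η x) ≤ R) → w = u ∨ w = v := by
      intro w hw
      by_contra hc
      push Not at hc
      have e1 := SimpleGraph.dist_eq_one_iff_adj.2 (hclose w u hw hu hc.1)
      have e2 := SimpleGraph.dist_eq_one_iff_adj.2 (hclose w v hw hv hc.2)
      exact hT.dist_ne_of_adj w huv (e1.trans e2.symm)
    refine ⟨u, v, huv, fun γ => ?_⟩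
    have hne : c γ u ≠ c γ v := fun h => hvu ((c γ).injective h).symm
    rcases htwo _ (hinv γ u hu) with a | a <;> rcases htwo _ (hinv γ v hv) with b | b
    · exact absurd (a.trans b.symm) hne
    · exact Or.inl ⟨a, b⟩
    · exact Or.inr ⟨a, b⟩
    · exact absurd (a.trans b.symm) hne

lemma lp_fin (f : lp (fun _ : OEdges T => ℂ) 2) :
    {e : OEdges T | 1 ≤ ‖(f : ∀ _ : OEdges T, ℂ) e‖}.Finite := by
  have h := (lp.memℓp f).summable (by norm_num)
  have h2 := h.tendsto_cofinite_zero.eventually (gt_mem_nhds (zero_lt_one))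
  rw [Filter.eventually_cofinite] at h2
  refine h2.subset ?_
  intro e he
  simp only [Set.mem_ofPred_eq, not_lt] at he ⊢
  exact Real.one_le_rpow he (by norm_num)

end Helpers

/-- **Proposition 5.2.** A group acting on a tree either fixes a vertex, or preserves an
edge, or has nonvanishing first cohomology with coefficients in `ℓ²` of the oriented
edges. -/
theorem tree_action_trichotomy
    {Γ : Type*} [Group Γ] {V : Type*} (T : SimpleGraph V)
    (hconn : T.Connected) (hacyc : T.IsAcyclic)
    (c : Γ →* Equiv.Perm V)
    (hadj : ∀ (γ : Γ) (u v : V), T.Adj u v → T.Adj (c γ u) (c γ v)) :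
    (∃ w : V, ∀ γ : Γ, c γ w = w) ∨
    (∃ u v : V, T.Adj u v ∧ ∀ γ : Γ, (c γ u = u ∧ c γ v = v) ∨ (c γ u = v ∧ c γ v = u)) ∨
    (∃ b : Γ → lp (fun _ : OEdges T => ℂ) 2,
      (∀ (γ η : Γ) (e : OEdges T),
        (b (γ * η) : ∀ _ : OEdges T, ℂ) e
          = (b γ : ∀ _ : OEdges T, ℂ) e
            + (b η : ∀ _ : OEdges T, ℂ) ⟨(c γ⁻¹ e.1.1, c γ⁻¹ e.1.2), hadj γ⁻¹ e.1.1 e.1.2 e.2⟩) ∧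
      ¬ ∃ f : lp (fun _ : OEdges T => ℂ) 2, ∀ (γ : Γ) (e : OEdges T),
        (b γ : ∀ _ : OEdges T, ℂ) e
          = (f : ∀ _ : OEdges T, ℂ) ⟨(c γ⁻¹ e.1.1, c γ⁻¹ e.1.2), hadj γ⁻¹ e.1.1 e.1.2 e.2⟩
            - (f : ∀ _ : OEdges T, ℂ) e) := by
  have hT : T.IsTree := ⟨hconn, hacyc⟩
  have hcinv : ∀ γ u, c γ (c γ⁻¹ u) = u := by
    intro γ u
    rw [← Equiv.Perm.mul_apply, ← map_mul]; simp
  have hcinv' : ∀ γ u, c γ⁻¹ (c γ u) = u := by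
    intro γ u
    rw [← Equiv.Perm.mul_apply, ← map_mul]; simp
  have hdle : ∀ γ u v, T.dist (c γ u) (c γ v) ≤ T.dist u v := by
    intro γ u v
    obtain ⟨p, hp⟩ := hconn.exists_walk_length_eq_dist u v
    let φ : T →g T := ⟨c γ, fun {a b} h => hadj γ a b h⟩
    have := SimpleGraph.dist_le (p.map φ)
    rw [SimpleGraph.Walk.length_map, hp] at this
    exact this
  have hd : ∀ γ u v, T.dist (c γ u) (c γ v) = T.dist u v := by
    intro γ u v
    refine le_antisymm (hdle γ u v) ?_
    have := hdle γ⁻¹ (c γ u) (c γ v)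
    rwa [hcinv', hcinv'] at this
  obtain ⟨x⟩ := hconn.nonempty
  let act : Γ → OEdges T → OEdges T := fun γ e =>
    ⟨(c γ⁻¹ e.1.1, c γ⁻¹ e.1.2), hadj γ⁻¹ e.1.1 e.1.2 e.2⟩
  have hact : ∀ γ e, hdir T x (act γ e) = hdir T (c γ x) e := by
    intro γ e
    have e1 := hd γ x (c γ⁻¹ e.1.1)
    have e2 := hd γ x (c γ⁻¹ e.1.2)
    rw [hcinv] at e1 e2
    simp only [hdir, act, e1, e2]
  have hmem : ∀ γ, Memℓp (fun e : OEdges T => ((hdir T x (act γ e) - hdir T x e : ℤ) : ℂ)) 2 := by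
    intro γ
    refine (memℓp_zero ?_).of_exponent_ge zero_le
    refine (hdir_fin hT (c γ x) x).subset ?_
    intro e he h
    apply he
    simp [hact, h]
  by_cases hbd : ∃ N, ∀ γ, T.dist x (c γ x) ≤ N
  · obtain ⟨N, hN⟩ := hbd
    rcases center hT c hd x N hN with h | h
    · exact Or.inl h
    · exact Or.inr (Or.inl h)
  right; right
  refine ⟨fun γ => ⟨_, hmem γ⟩, ?_, ?_⟩
  · intro γ η e
    have : act (γ * η) e = act η (act γ e) := by
      simp only [act, mul_inv_rev, map_mul, Equiv.Perm.mul_apply]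
    change ((hdir T x (act (γ * η) e) - hdir T x e : ℤ) : ℂ) =
      ((hdir T x (act γ e) - hdir T x e : ℤ) : ℂ) +
      ((hdir T x (act η (act γ e)) - hdir T x (act γ e) : ℤ) : ℂ)
    rw [this]; push_cast; ring
  · rintro ⟨f, hf⟩
    apply hbd
    classical
    have hK := lp_fin f
    have hinj : ∀ γ, Function.Injective (act γ) := by
      intro γ e e' h
      have h' := congrArg Subtype.val h
      simp only [act, Prod.mk.injEq, EmbeddingLike.apply_eq_iff_eq] at h'
      exact Subtype.ext (Prod.ext h'.1 h'.2)
    refine ⟨hK.toFinset.card + hK.toFinset.card, fun γ => ?_⟩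
    obtain ⟨g, hg, hga⟩ := geod hT x (c γ x)
    let ed : Fin (T.dist x (c γ x)) → OEdges T := fun i => ⟨(g i, g (i+1)), hga i i.2⟩
    have hed : Function.Injective ed := by
      intro i j h
      have h' : g i = g j := congrArg (fun e : OEdges T => e.1.1) h
      have h1 := (hg i i.2.le).1
      rw [h', (hg j j.2.le).1] at h1
      exact Fin.ext h1.symm
    have hval : ∀ i, hdir T x (act γ (ed i)) - hdir T x (ed i) = -2 := by
      intro i
      rw [hact]
      have h1 := hg i i.2.le
      have h2 := hg (i+1) i.2
      have := i.2
      simp only [hdir, ed]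
      rw [T.dist_comm (u := c γ x), T.dist_comm (u := c γ x), h1.1, h1.2, h2.1, h2.2]
      omega
    have hor : ∀ i, ed i ∈ hK.toFinset ∨ act γ (ed i) ∈ hK.toFinset := by
      intro i
      by_contra hc
      simp only [Set.Finite.mem_toFinset, Set.mem_ofPred_eq, not_or, not_le] at hc
      have h1 : ((hdir T x (act γ (ed i)) - hdir T x (ed i) : ℤ) : ℂ) = f (act γ (ed i)) - f (ed i) :=
        hf γ (ed i)
      rw [hval] at h1
      have h2 := norm_sub_le (f (act γ (ed i))) (f (ed i))
      rw [← h1] at h2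
      norm_num at h2
      linarith [hc.1, hc.2]
    have hsub : (Finset.univ : Finset (Fin (T.dist x (c γ x)))) ⊆
        (Finset.univ.filter fun i => ed i ∈ hK.toFinset) ∪
        (Finset.univ.filter fun i => act γ (ed i) ∈ hK.toFinset) := by
      intro i _
      rcases hor i with h | h
      · exact Finset.mem_union_left _ (Finset.mem_filter.2 ⟨Finset.mem_univ _, h⟩)
      · exact Finset.mem_union_right _ (Finset.mem_filter.2 ⟨Finset.mem_univ _, h⟩)
    have h1 := (Finset.card_le_card hsub).trans (Finset.card_union_le _ _)
    rw [Finset.card_univ, Fintype.card_fin] at h1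
    refine h1.trans (add_le_add ?_ ?_)
    · exact Finset.card_le_card_of_injOn ed (fun i hi => (Finset.mem_filter.1 hi).2) hed.injOn
    · exact Finset.card_le_card_of_injOn (fun i => act γ (ed i))
        (fun i hi => (Finset.mem_filter.1 hi).2) ((hinj γ).comp hed).injOn

end
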